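/- Let d_w, d_v be positive integers and let X, Y be real d_w × d_v matrices. Then P(h(X) ≠ h(Y)) = (8/π²)·Σ_{m=1}^∞ (1 − κ_b(m·(X−Y)))/(4m² − 1), where the probability is over (w, v, b, t). -/

import Mathlib

open MeasureTheory ProbabilityTheory Matrix Real

/-- Standard Gaussian measure on ℝ^d (i.i.d. N(0,1) entries). -/
noncomputable def stdGaussian (d : ℕ) : Measure (Fin d → ℝ) :=
  Measure.pi fun _ => ProbabilityTheory.gaussianReal 0 1

/-- Uniform probability measure on the interval [a, b]. -/
noncomputable def unifIcc (a b : ℝ) : Measure ℝ :=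
  (ENNReal.ofReal (b - a))⁻¹ • MeasureTheory.volume.restrict (Set.Icc a b)

/-- κ_b(A) = det(I + A Aᵀ)^(−1/2). -/
noncomputable def kb {dw dv : ℕ} (A : Matrix (Fin dw) (Fin dv) ℝ) : ℝ :=
  (Matrix.det (1 + A * Aᵀ)) ^ (-(1 / 2 : ℝ))

/-- Gaussian kernel κ_g(A) = exp(−‖A‖_F²/2). -/
noncomputable def kg {dw dv : ℕ} (A : Matrix (Fin dw) (Fin dv) ℝ) : ℝ :=
  Real.exp (-(∑ i, ∑ j, (A i j) ^ 2) / 2)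

/-- Binary quantizer sgn(z) = 1 if z ≥ 0, else 0. -/
noncomputable def sgn01 (z : ℝ) : ℝ := if 0 ≤ z then 1 else 0

/-- Joint law of (w, v, b, t): w ~ N(0, I_{d_w}), v ~ N(0, I_{d_v}),
b ~ Unif[0, 2π], t ~ Unif[−1, 1], mutually independent. -/
noncomputable def hashLaw (dw dv : ℕ) :
    Measure ((Fin dw → ℝ) × (Fin dv → ℝ) × ℝ × ℝ) :=
  (stdGaussian dw).prod ((stdGaussian dv).prod ((unifIcc 0 (2 * π)).prod (unifIcc (-1) 1)))

/-- The hash bit h(X) = sgn(cos(wᵀ X v + b) + t) as a function of (w, v, b, t). -/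
noncomputable def hashBit {dw dv : ℕ} (X : Matrix (Fin dw) (Fin dv) ℝ)
    (p : (Fin dw → ℝ) × (Fin dv → ℝ) × ℝ × ℝ) : ℝ :=
  sgn01 (Real.cos (p.1 ⬝ᵥ (X *ᵥ p.2.1) + p.2.2.1) + p.2.2.2)


lemma aux_hs {ι : Type*} {f g : ι → ℝ} {a b : ℝ} (h : HasSum f a) (hfg : ∀ i, g i = f i) (hab : b = a) :
    HasSum g b := by
  rw [hab, funext hfg]; exact h

lemma aux_fc (n : ℤ) (f : AddCircle π → ℂ) [Fact (0 < π)] (hf : ∀ x : ℝ, f x = ((|Real.sin x| : ℝ) : ℂ)) :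
    fourierCoeff f n = ((2 / π / (1 - 4 * (n:ℝ)^2) : ℝ) : ℂ) := by
  rw [fourierCoeff_eq_intervalIntegral f n 0]
  have hne : (1 - 4 * (n:ℂ)^2) ≠ 0 := by
    have : (1 - 4 * n^2 : ℤ) ≠ 0 := by omega
    exact_mod_cast this
  have hpi : (π : ℂ) ≠ 0 := by exact_mod_cast Real.pi_ne_zero
  have h1 : ∫ x in (0:ℝ)..0 + π, @fourier π (-n) x • f x
      = ∫ x in (0:ℝ)..π, Complex.exp (-2 * Complex.I * n * x) * Complex.sin x := by
    rw [zero_add]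
    apply intervalIntegral.integral_congr
    intro x hx
    rw [Set.uIcc_of_le Real.pi_pos.le] at hx
    simp only [smul_eq_mul]
    rw [hf, abs_of_nonneg (Real.sin_nonneg_of_nonneg_of_le_pi hx.1 hx.2), fourier_coe_apply]
    push_cast
    congr 2
    field_simp
  rw [h1]
  have h2 : ∀ x ∈ Set.uIcc (0:ℝ) π, HasDerivAt (fun x : ℝ =>
      Complex.exp (-2 * Complex.I * n * x) * (-2 * Complex.I * n * Complex.sin x - Complex.cos x) / (1 - 4 * (n:ℂ)^2))
      (Complex.exp (-2 * Complex.I * n * x) * Complex.sin x) x := by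
    intro x _
    have e1 : HasDerivAt (fun z : ℂ => Complex.exp (-2 * Complex.I * n * z))
        (Complex.exp (-2 * Complex.I * n * x) * (-2 * Complex.I * n)) (x:ℂ) := by
      have := ((hasDerivAt_id (x:ℂ)).const_mul (-2 * Complex.I * n)).cexp
      simpa using this
    have e2 : HasDerivAt (fun z : ℂ => (-2 * Complex.I * n * Complex.sin z - Complex.cos z))
        (-2 * Complex.I * n * Complex.cos x - -Complex.sin x) (x:ℂ) :=
      ((Complex.hasDerivAt_sin _).const_mul _).sub (Complex.hasDerivAt_cos _)
    have e3 := ((e1.mul e2).div_const (1 - 4 * (n:ℂ)^2)).comp_ofReal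
    refine HasDerivAt.congr_deriv (f := fun x : ℝ =>
      Complex.exp (-2 * Complex.I * n * x) * (-2 * Complex.I * n * Complex.sin x - Complex.cos x) / (1 - 4 * (n:ℂ)^2)) e3 ?_
    symm
    rw [eq_div_iff hne]
    linear_combination (-4 * Complex.exp (-2 * Complex.I * n * x) * Complex.sin x * n^2) * Complex.I_sq
  rw [intervalIntegral.integral_eq_sub_of_hasDerivAt h2 (by
    apply Continuous.intervalIntegrable; fun_prop)]
  have h3 : Complex.exp (-2 * Complex.I * n * π) = 1 := by
    rw [Complex.exp_eq_one_iff]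
    exact ⟨-n, by push_cast; ring⟩
  rw [h3]
  simp
  field_simp
  ring

lemma aux_fourier (x : ℝ) : HasSum (fun m : ℕ+ => (1 - Real.cos (2 * m * x)) / (4 * (m:ℝ)^2 - 1))
    (π / 4 * |Real.sin x|) := by
  have : Fact (0 < π) := ⟨Real.pi_pos⟩
  have hper : Function.Periodic (fun x : ℝ => ((|Real.sin x| : ℝ) : ℂ)) π := by
    intro x; simp [Real.sin_add_pi]
  let f : C(AddCircle π, ℂ) := ⟨hper.lift, by
    apply continuous_coinduced_dom.mpr
    change Continuous (fun x : ℝ => ((|Real.sin x| : ℝ) : ℂ))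
    fun_prop⟩
  have hf : ∀ x : ℝ, f x = ((|Real.sin x| : ℝ) : ℂ) := fun x => hper.lift_coe x
  have hc : ∀ n, fourierCoeff f n = ((2 / π / (1 - 4 * (n:ℝ)^2) : ℝ) : ℂ) := fun n => aux_fc n f hf
  have hs : Summable (fourierCoeff f) := by
    have : (fourierCoeff f : ℤ → ℂ) = fun n : ℤ => ((2 / π / (1 - 4 * (n:ℝ)^2) : ℝ) : ℂ) := funext hc
    rw [this, Complex.summable_ofReal]
    have hz : Summable (fun n : ℤ => 1 / (n:ℝ)^2) := Real.summable_one_div_int_pow.mpr (by norm_num)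
    refine Summable.of_norm_bounded_eventually (hz.mul_left (2/π)) ?_
    have : ({0} : Set ℤ).Finite := Set.finite_singleton 0
    filter_upwards [this.compl_mem_cofinite] with n hn
    have hn1 : (1:ℝ) ≤ (n:ℝ)^2 := by
      have : (1:ℤ) ≤ n^2 := by
        have : n ≠ 0 := by simpa using hn
        have := sq_nonneg n
        have : n^2 ≠ 0 := by positivity
        omega
      exact_mod_cast this
    rw [Real.norm_eq_abs, abs_div, abs_of_pos (by positivity : 2/π > 0), abs_of_neg (by linarith), mul_one_div]
    gcongr
    linarith
  have key : ∀ x : ℝ, HasSum (fun n : ℤ => 2 / π / (1 - 4 * (n:ℝ)^2) * Real.cos (2 * n * x)) |Real.sin x| := by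
    intro x
    have h := Complex.hasSum_re (has_pointwise_sum_fourier_series_of_summable hs (x : AddCircle π))
    rw [hf, Complex.ofReal_re] at h
    convert h using 2 with n
    rw [hc, fourier_coe_apply, smul_eq_mul, Complex.re_ofReal_mul]
    congr 1
    rw [← Complex.exp_ofReal_mul_I_re]
    congr 2
    have hpi : (π : ℂ) ≠ 0 := by exact_mod_cast Real.pi_ne_zero
    push_cast
    field_simp
  have k2 := ((key 0).sub (key x)).mul_left (-(π / 4))
  simp only [mul_zero, Real.cos_zero, mul_one, Real.sin_zero, abs_zero, zero_sub] at k2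
  have k3 := k2.nat_add_neg
  have : Function.Injective (fun m : ℕ+ => (m:ℕ)) := PNat.coe_injective
  rw [← this.hasSum_iff] at k3
  · refine aux_hs k3 ?_ ?_
    · intro m
      simp only [Function.comp]
      have hm : (1:ℝ) ≤ (m:ℝ) := by exact_mod_cast m.one_le
      have h1 : (4 * (m:ℝ)^2 - 1) ≠ 0 := by nlinarith
      have h2 : (1 - 4 * (m:ℝ)^2) ≠ 0 := by nlinarith
      push_cast
      rw [show (2 * -(m:ℝ) * x) = -(2 * m * x) by ring, Real.cos_neg, neg_sq,
        show (1 - 4 * (m:ℝ)^2) = -(4 * (m:ℝ)^2 - 1) by ring]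
      field_simp
      ring
    · simp
  · intro n hn
    have : n = 0 := by
      by_contra h
      exact hn ⟨⟨n, Nat.pos_of_ne_zero h⟩, rfl⟩
    subst this
    simp
lemma aux_gauss1 (l : ℝ) (hl : 0 ≤ l) :
    ∫ x, Real.exp (-(l * x^2) / 2) ∂(gaussianReal 0 1) = (1 + l) ^ (-(1/2:ℝ)) := by
  rw [integral_gaussianReal_eq_integral_smul one_ne_zero]
  have : ∀ x : ℝ, gaussianPDFReal 0 1 x • Real.exp (-(l * x^2) / 2)
      = (√(2 * π))⁻¹ * Real.exp (-((1 + l)/2) * x^2) := by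
    intro x
    simp only [gaussianPDFReal, smul_eq_mul, NNReal.coe_one, mul_one, sub_zero]
    rw [mul_assoc, ← Real.exp_add]
    congr 2
    ring
  simp_rw [this]
  rw [integral_const_mul, integral_gaussian, ← Real.sqrt_inv, ← Real.sqrt_mul (by positivity),
    Real.rpow_neg (by positivity), ← Real.sqrt_eq_rpow, ← Real.sqrt_inv]
  congr 1
  field_simp

lemma aux_gaussD {d : ℕ} (M : Matrix (Fin d) (Fin d) ℝ) (hM : M.PosSemidef) :
    ∫ w, Real.exp (-(w ⬝ᵥ (M *ᵥ w)) / 2) ∂(_root_.stdGaussian d) = (Matrix.det (1 + M)) ^ (-(1/2:ℝ)) := by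
  have hA := hM.isHermitian
  have e1 : (_root_.stdGaussian d) = Measure.map (WithLp.ofLp) (ProbabilityTheory.stdGaussian (EuclideanSpace ℝ (Fin d))) := by
    rw [← map_pi_eq_stdGaussian, Measure.map_map (by fun_prop) (by fun_prop)]
    have : (WithLp.ofLp ∘ WithLp.toLp 2 : (Fin d → ℝ) → (Fin d → ℝ)) = id := rfl
    rw [this, Measure.map_id]; rfl
  have hq : ∀ x : Fin d → ℝ, ((∑ i, x i • hA.eigenvectorBasis i : EuclideanSpace ℝ (Fin d)).ofLp ⬝ᵥ
      (M *ᵥ (∑ i, x i • hA.eigenvectorBasis i : EuclideanSpace ℝ (Fin d)).ofLp)) = ∑ i, hA.eigenvalues i * x i ^ 2 := by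
    intro x
    have h1 : M *ᵥ (∑ i, x i • hA.eigenvectorBasis i : EuclideanSpace ℝ (Fin d)).ofLp
      = (∑ i, (x i * hA.eigenvalues i) • hA.eigenvectorBasis i : EuclideanSpace ℝ (Fin d)).ofLp := by
      simp only [WithLp.ofLp_sum, WithLp.ofLp_smul, Matrix.mulVec_sum, Matrix.mulVec_smul, hA.mulVec_eigenvectorBasis, smul_smul]
    rw [h1]
    have h2 : ∀ a b : EuclideanSpace ℝ (Fin d), a.ofLp ⬝ᵥ b.ofLp = inner ℝ b a := by
      intro a b; simp [EuclideanSpace.inner_eq_star_dotProduct]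
    rw [h2, sum_inner]
    simp only [inner_smul_left, hA.eigenvectorBasis.inner_eq_ite, inner_sum, inner_smul_right]
    simp
    exact Finset.sum_congr rfl fun i _ => by ring
  rw [e1, integral_map (by fun_prop) (by
    apply Continuous.aestronglyMeasurable; fun_prop),
    stdGaussian_eq_map_pi_orthonormalBasis hA.eigenvectorBasis, integral_map (Measurable.aemeasurable (by fun_prop)) (by
    apply Continuous.aestronglyMeasurable; fun_prop)]
  simp_rw [hq]
  have : ∀ x : Fin d → ℝ, Real.exp (-(∑ i, hA.eigenvalues i * x i ^ 2) / 2) =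
      ∏ i, Real.exp (-(hA.eigenvalues i * x i ^ 2) / 2) := by
    intro x
    rw [← Real.exp_sum, ← Finset.sum_div, Finset.sum_neg_distrib]
  simp_rw [this]
  rw [integral_fintype_prod_eq_prod (fun i x => Real.exp (-(hA.eigenvalues i * x ^ 2) / 2))]
  have hev := hM.eigenvalues_nonneg
  have hdet : Matrix.det (1 + M) = ∏ i, (1 + hA.eigenvalues i) := by
    have h := congrArg (Polynomial.eval (-1)) hA.charpoly_eq
    rw [Matrix.eval_charpoly, Polynomial.eval_prod] at h
    have h3 : (Matrix.scalar (Fin d) (-1:ℝ) - M) = -(1 + M) := by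
      rw [map_neg, map_one]; abel
    rw [h3, Matrix.det_neg] at h
    simp only [Polynomial.eval_sub, Polynomial.eval_X, Polynomial.eval_C] at h
    have h4 : ∏ i, (-1 - (RCLike.ofReal (hA.eigenvalues i) : ℝ)) = (-1)^(Fintype.card (Fin d)) * ∏ i, (1 + hA.eigenvalues i) := by
      rw [Fintype.card, ← Finset.prod_const, ← Finset.prod_mul_distrib]
      refine Finset.prod_congr rfl fun i _ => ?_
      simp; ring
    rw [h4] at h
    exact mul_left_cancel₀ (by simp) h
  rw [hdet, ← Real.finsetProd_rpow _ _ (fun i _ => by linarith [hev i])]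
  exact Finset.prod_congr rfl fun i _ => aux_gauss1 _ (hev i)

instance {d : ℕ} : IsProbabilityMeasure (_root_.stdGaussian d) := by
  unfold _root_.stdGaussian; infer_instance

lemma aux_cos {d : ℕ} (u : Fin d → ℝ) :
    ∫ v, Real.cos (u ⬝ᵥ v) ∂(_root_.stdGaussian d) = Real.exp (-(u ⬝ᵥ u) / 2) := by
  have h : ∫ v, Complex.exp ((u ⬝ᵥ v : ℝ) * Complex.I) ∂(_root_.stdGaussian d)
      = Complex.exp ((-(u ⬝ᵥ u) / 2 : ℝ)) := by
    have : ∀ v : Fin d → ℝ, Complex.exp ((u ⬝ᵥ v : ℝ) * Complex.I) = ∏ i, Complex.exp (u i * v i * Complex.I) := by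
      intro v
      rw [← Complex.exp_sum, ← Finset.sum_mul]
      simp [dotProduct]
    simp_rw [this]
    unfold _root_.stdGaussian
    rw [integral_fintype_prod_eq_prod (fun i (x:ℝ) => Complex.exp (u i * x * Complex.I))]
    simp_rw [← charFun_apply_real, charFun_gaussianReal]
    rw [← Complex.exp_sum]
    congr 1
    simp [dotProduct, Finset.sum_div, neg_div]
    exact Finset.sum_congr rfl fun i _ => by ring
  have h2 := congrArg Complex.re h
  rw [Complex.exp_ofReal_re] at h2
  rw [← h2]
  have hi : Integrable (fun v => Complex.exp ((u ⬝ᵥ v : ℝ) * Complex.I)) (_root_.stdGaussian d) := by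
    refine Integrable.of_bound (C := 1) ?_ ?_
    · apply Continuous.aestronglyMeasurable; unfold dotProduct; fun_prop
    · exact Filter.Eventually.of_forall fun v => by rw [Complex.norm_exp_ofReal_mul_I]
  have h3 := integral_re (𝕜 := ℂ) hi
  simp only [RCLike.re_eq_complex_re] at h3
  rw [← h3]
  simp_rw [Complex.exp_ofReal_mul_I_re]

lemma aux_kb {dw dv : ℕ} (Z : Matrix (Fin dw) (Fin dv) ℝ) :
    ∫ w, ∫ v, Real.cos (w ⬝ᵥ (Z *ᵥ v)) ∂(_root_.stdGaussian dv) ∂(_root_.stdGaussian dw) = kb Z := by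
  simp_rw [Matrix.dotProduct_mulVec, aux_cos]
  have : ∀ w : Fin dw → ℝ, (w ᵥ* Z) ⬝ᵥ (w ᵥ* Z) = w ⬝ᵥ ((Z * Zᵀ) *ᵥ w) := by
    intro w
    rw [← Matrix.mulVec_mulVec, Matrix.dotProduct_mulVec, Matrix.mulVec_transpose]
  simp_rw [this]
  rw [aux_gaussD _ (by simpa using Matrix.posSemidef_self_mul_conjTranspose Z)]
  rfl
lemma aux_t (p q : ℝ) (hp : p ∈ Set.Icc (-1:ℝ) 1) (hq : q ∈ Set.Icc (-1:ℝ) 1) :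
    unifIcc (-1) 1 {t | sgn01 (p + t) ≠ sgn01 (q + t)} = ENNReal.ofReal (|p - q| / 2) := by
  have hset : {t | sgn01 (p + t) ≠ sgn01 (q + t)} = Set.Ico (-(max p q)) (-(min p q)) := by
    ext t
    simp only [Set.mem_setOf_eq, Set.mem_Ico, sgn01]
    rcases le_total p q with h | h
    · rw [max_eq_right h, min_eq_left h]
      split_ifs with h1 h2 h2 <;> simp <;> intros <;> (try constructor) <;> linarith
    · rw [max_eq_left h, min_eq_right h]
      split_ifs with h1 h2 h2 <;> simp <;> intros <;> (try constructor) <;> linarith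
  have hsub : Set.Ico (-(max p q)) (-(min p q)) ⊆ Set.Icc (-1) 1 := by
    intro t ht
    have h1 : max p q ≤ 1 := max_le hp.2 hq.2
    have h2 : -1 ≤ min p q := le_min hp.1 hq.1
    exact ⟨by linarith [ht.1], by linarith [ht.2]⟩
  rw [hset, unifIcc, Measure.smul_apply, Measure.restrict_apply measurableSet_Ico,
    Set.inter_eq_left.mpr hsub, Real.volume_Ico, smul_eq_mul, ← ENNReal.ofReal_inv_of_pos (by norm_num),
    ← ENNReal.ofReal_mul (by norm_num)]
  congr 1
  rw [← max_sub_min_eq_abs']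
  ring

lemma aux_intsin (s : ℝ) : ∫ b in (0:ℝ)..2 * π, |Real.sin (s + b)| = 4 := by
  have hper : Function.Periodic (fun x : ℝ => |Real.sin x|) π := by
    intro x; simp [Real.sin_add_pi]
  have hper2 : Function.Periodic (fun x : ℝ => |Real.sin x|) (2 * π) := by
    intro x; simp
  have hi : ∀ a b : ℝ, IntervalIntegrable (fun x : ℝ => |Real.sin x|) volume a b := fun a b =>
    Continuous.intervalIntegrable (by fun_prop) _ _
  have h1 : ∫ x in (0:ℝ)..π, |Real.sin x| = 2 := by
    have h0 : ∫ x in (0:ℝ)..π, Real.sin x = 2 := by rw [integral_sin]; norm_num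
    rw [← h0]
    apply intervalIntegral.integral_congr
    intro x hx
    rw [Set.uIcc_of_le Real.pi_pos.le] at hx
    exact abs_of_nonneg (Real.sin_nonneg_of_nonneg_of_le_pi hx.1 hx.2)
  have h2 : ∫ x in π..(π + π), |Real.sin x| = 2 := by
    rw [hper.intervalIntegral_add_eq π 0, zero_add, h1]
  rw [intervalIntegral.integral_comp_add_left (fun x => |Real.sin x|) s, add_zero,
    hper2.intervalIntegral_add_eq s 0, zero_add, two_mul,
    ← intervalIntegral.integral_add_adjacent_intervals (hi 0 π) (hi π _), h1, h2]
  norm_num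

lemma aux_meas_sgn : Measurable sgn01 := by
  unfold sgn01
  exact Measurable.ite measurableSet_Ici measurable_const measurable_const

instance : SFinite (unifIcc (-1) 1) := by unfold unifIcc; infer_instance
instance : SFinite (unifIcc 0 (2 * π)) := by unfold unifIcc; infer_instance

lemma aux_bt (a c : ℝ) :
    ((unifIcc 0 (2 * π)).prod (unifIcc (-1) 1))
      {q | sgn01 (Real.cos (a + q.1) + q.2) ≠ sgn01 (Real.cos (c + q.1) + q.2)}
      = ENNReal.ofReal (2 / π * |Real.sin ((a - c) / 2)|) := by
  have hm : MeasurableSet {q : ℝ × ℝ | sgn01 (Real.cos (a + q.1) + q.2) ≠ sgn01 (Real.cos (c + q.1) + q.2)} := by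
    have h1 : Measurable (fun q : ℝ × ℝ => sgn01 (Real.cos (a + q.1) + q.2)) :=
      aux_meas_sgn.comp (by fun_prop)
    have h2 : Measurable (fun q : ℝ × ℝ => sgn01 (Real.cos (c + q.1) + q.2)) :=
      aux_meas_sgn.comp (by fun_prop)
    exact (measurableSet_eq_fun h1 h2).compl
  rw [Measure.prod_apply hm]
  have : ∀ b : ℝ, unifIcc (-1) 1 (Prod.mk b ⁻¹' {q : ℝ × ℝ | sgn01 (Real.cos (a + q.1) + q.2) ≠ sgn01 (Real.cos (c + q.1) + q.2)})
      = ENNReal.ofReal (|Real.sin ((a + c) / 2 + b)| * |Real.sin ((a - c) / 2)|) := by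
    intro b
    have := aux_t (Real.cos (a + b)) (Real.cos (c + b)) ⟨Real.neg_one_le_cos _, Real.cos_le_one _⟩
      ⟨Real.neg_one_le_cos _, Real.cos_le_one _⟩
    rw [Set.preimage_setOf_eq]
    rw [this, Real.cos_sub_cos]
    congr 1
    rw [abs_mul, abs_mul]
    norm_num
    rw [show (a + b + (c + b)) / 2 = (a + c) / 2 + b by ring]
    ring
  simp_rw [this]
  rw [unifIcc, lintegral_smul_measure, ← ofReal_integral_eq_lintegral_ofReal]
  · rw [integral_Icc_eq_integral_Ioc, ← intervalIntegral.integral_of_le (by positivity),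
      intervalIntegral.integral_mul_const, aux_intsin, smul_eq_mul,
      ← ENNReal.ofReal_inv_of_pos (by simp [Real.pi_pos]), ← ENNReal.ofReal_mul (by simp [Real.pi_pos.le])]
    congr 1
    field_simp
    ring
  · apply Continuous.integrableOn_Icc; fun_prop
  · exact Filter.Eventually.of_forall fun b => by positivity

lemma aux_int1 {dw dv : ℕ} (Z : Matrix (Fin dw) (Fin dv) ℝ) :
    ∫⁻ w, ∫⁻ v, ENNReal.ofReal (1 - Real.cos (w ⬝ᵥ (Z *ᵥ v))) ∂(_root_.stdGaussian dv) ∂(_root_.stdGaussian dw)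
      = ENNReal.ofReal (1 - kb Z) ∧ 0 ≤ 1 - kb Z := by
  have hc : Continuous (fun p : (Fin dw → ℝ) × (Fin dv → ℝ) => Real.cos (p.1 ⬝ᵥ (Z *ᵥ p.2))) := by
    fun_prop
  have hi : Integrable (fun p : (Fin dw → ℝ) × (Fin dv → ℝ) => Real.cos (p.1 ⬝ᵥ (Z *ᵥ p.2)))
      ((_root_.stdGaussian dw).prod (_root_.stdGaussian dv)) :=
    Integrable.of_bound (C := 1) hc.aestronglyMeasurable
      (Filter.Eventually.of_forall fun p => Real.abs_cos_le_one _)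
  have h1 : ∫ p : (Fin dw → ℝ) × (Fin dv → ℝ), (1 - Real.cos (p.1 ⬝ᵥ (Z *ᵥ p.2)))
      ∂((_root_.stdGaussian dw).prod (_root_.stdGaussian dv)) = 1 - kb Z := by
    rw [integral_sub (integrable_const _) hi, integral_prod _ hi, aux_kb]
    simp
  have hnn : ∀ x : ℝ, 0 ≤ 1 - Real.cos x := fun x => by linarith [Real.cos_le_one x]
  refine ⟨?_, ?_⟩
  · rw [← h1, ofReal_integral_eq_lintegral_ofReal (f := fun p : (Fin dw → ℝ) × (Fin dv → ℝ) => 1 - Real.cos (p.1 ⬝ᵥ (Z *ᵥ p.2))) ((integrable_const _).sub hi)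
      (Filter.Eventually.of_forall fun p => hnn _), lintegral_prod]
    exact (Continuous.measurable (ENNReal.continuous_ofReal.comp (by fun_prop))).aemeasurable
  · rw [← h1]
    exact integral_nonneg fun p => hnn _

open scoped ENNReal in
lemma aux_swap {α β : Type*} [MeasurableSpace α] [MeasurableSpace β] (μ : Measure α) (ν : Measure β)
    [SFinite ν] (c : ℕ+ → ℝ≥0∞) (g : ℕ+ → α → β → ℝ≥0∞)
    (hg : ∀ m, Measurable (fun p : α × β => g m p.1 p.2)) :
    ∫⁻ w, ∫⁻ v, ∑' m, c m * g m w v ∂ν ∂μ = ∑' m, c m * ∫⁻ w, ∫⁻ v, g m w v ∂ν ∂μ := by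
  have hw : ∀ m w, Measurable (fun v => g m w v) := fun m w => (hg m).comp measurable_prodMk_left
  have hw2 : ∀ m, Measurable (fun w => ∫⁻ v, g m w v ∂ν) := fun m => (hg m).lintegral_prod_right'
  have h1 : ∀ w, ∫⁻ v, ∑' m, c m * g m w v ∂ν = ∑' m, c m * ∫⁻ v, g m w v ∂ν := by
    intro w
    rw [lintegral_tsum fun m => ((hw m w).const_mul _).aemeasurable]
    exact tsum_congr fun m => lintegral_const_mul _ (hw m w)
  rw [lintegral_congr h1, lintegral_tsum fun m => ((hw2 m).const_mul _).aemeasurable]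
  exact tsum_congr fun m => lintegral_const_mul _ (hw2 m)

theorem expected_hamming_distance {dw dv : ℕ} (hdw : 0 < dw) (hdv : 0 < dv)
    (X Y : Matrix (Fin dw) (Fin dv) ℝ) :
    hashLaw dw dv {p | hashBit X p ≠ hashBit Y p} =
      ENNReal.ofReal (8 / π ^ 2 *
        ∑' m : ℕ+, (1 - kb ((m : ℝ) • (X - Y))) / (4 * (m : ℝ) ^ 2 - 1)) := by
  have hbm : ∀ X : Matrix (Fin dw) (Fin dv) ℝ, Measurable (hashBit X) := fun X =>
    aux_meas_sgn.comp (Continuous.measurable (by fun_prop))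
  have hm : MeasurableSet {p | hashBit X p ≠ hashBit Y p} :=
    (measurableSet_eq_fun (hbm X) (hbm Y)).compl
  have hden : ∀ m : ℕ+, (0:ℝ) < 4 * (m:ℝ)^2 - 1 := fun m => by
    have hm : (1:ℝ) ≤ (m:ℝ) := by exact_mod_cast m.one_le
    nlinarith
  have hnn : ∀ x : ℝ, 0 ≤ 1 - Real.cos x := fun x => by linarith [Real.cos_le_one x]
  set Z := X - Y with hZ
  have hkey : ∀ w v, (((unifIcc 0 (2 * π)).prod (unifIcc (-1) 1)))
      (Prod.mk v ⁻¹' (Prod.mk w ⁻¹' {p | hashBit X p ≠ hashBit Y p}))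
      = ∑' m : ℕ+, ENNReal.ofReal (8 / π^2 / (4 * (m:ℝ)^2 - 1)) *
        ENNReal.ofReal (1 - Real.cos (w ⬝ᵥ (((m:ℝ) • Z) *ᵥ v))) := by
    intro w v
    have h := aux_bt (w ⬝ᵥ (X *ᵥ v)) (w ⬝ᵥ (Y *ᵥ v))
    have hs := (aux_fourier ((w ⬝ᵥ (X *ᵥ v) - w ⬝ᵥ (Y *ᵥ v)) / 2)).mul_left (8 / π^2)
    have e : 8 / π^2 * (π / 4 * |Real.sin ((w ⬝ᵥ (X *ᵥ v) - w ⬝ᵥ (Y *ᵥ v)) / 2)|) =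
        2 / π * |Real.sin ((w ⬝ᵥ (X *ᵥ v) - w ⬝ᵥ (Y *ᵥ v)) / 2)| := by
      field_simp
      ring
    rw [e] at hs
    refine Eq.trans h ?_
    rw [← hs.tsum_eq, ENNReal.ofReal_tsum_of_nonneg _ hs.summable]
    · congr 1
      funext m
      rw [← ENNReal.ofReal_mul (div_nonneg (by positivity) (hden m).le)]
      congr 1
      rw [Matrix.smul_mulVec, dotProduct_smul, hZ, Matrix.sub_mulVec, dotProduct_sub, smul_eq_mul]
      rw [show 2 * (m:ℝ) * ((w ⬝ᵥ (X *ᵥ v) - w ⬝ᵥ (Y *ᵥ v)) / 2) = m * (w ⬝ᵥ (X *ᵥ v) - w ⬝ᵥ (Y *ᵥ v)) by ring]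
      ring
    · intro m
      have := hden m
      have := hnn (2 * m * ((w ⬝ᵥ (X *ᵥ v) - w ⬝ᵥ (Y *ᵥ v)) / 2))
      positivity
  have hmeas : ∀ m : ℕ+, Measurable (fun p : (Fin dw → ℝ) × (Fin dv → ℝ) =>
      ENNReal.ofReal (1 - Real.cos (p.1 ⬝ᵥ (((m:ℝ) • Z) *ᵥ p.2)))) := fun m =>
    Continuous.measurable (ENNReal.continuous_ofReal.comp (by fun_prop))
  have hmain : hashLaw dw dv {p | hashBit X p ≠ hashBit Y p} =
      ∑' m : ℕ+, ENNReal.ofReal (8 / π^2 * ((1 - kb ((m : ℝ) • Z)) / (4 * (m : ℝ) ^ 2 - 1))) := by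
    rw [hashLaw, Measure.prod_apply hm]
    have h1 : ∀ w, ((_root_.stdGaussian dv).prod ((unifIcc 0 (2 * π)).prod (unifIcc (-1) 1)))
        (Prod.mk w ⁻¹' {p | hashBit X p ≠ hashBit Y p}) =
        ∫⁻ v, ∑' m : ℕ+, ENNReal.ofReal (8 / π^2 / (4 * (m:ℝ)^2 - 1)) *
          ENNReal.ofReal (1 - Real.cos (w ⬝ᵥ (((m:ℝ) • Z) *ᵥ v))) ∂(_root_.stdGaussian dv) := by
      intro w
      rw [Measure.prod_apply (measurable_prodMk_left hm)]
      exact lintegral_congr fun v => hkey w v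
    rw [lintegral_congr h1]
    rw [aux_swap (_root_.stdGaussian dw) (_root_.stdGaussian dv) _ (fun (m : ℕ+) w v =>
      ENNReal.ofReal (1 - Real.cos (w ⬝ᵥ (((m:ℝ) • Z) *ᵥ v)))) hmeas]
    congr 1
    funext m
    rw [(aux_int1 _).1,
      ← ENNReal.ofReal_mul (div_nonneg (by positivity) (hden m).le)]
    congr 1
    ring
  have hnon : ∀ m : ℕ+, 0 ≤ 8 / π^2 * ((1 - kb ((m : ℝ) • Z)) / (4 * (m : ℝ) ^ 2 - 1)) := fun m =>
    mul_nonneg (by positivity) (div_nonneg (aux_int1 _).2 (hden m).le)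
  have hsum : Summable fun m : ℕ+ => 8 / π^2 * ((1 - kb ((m : ℝ) • Z)) / (4 * (m : ℝ) ^ 2 - 1)) := by
    have hkb : ∀ m : ℕ+, 0 ≤ kb ((m : ℝ) • Z) := fun m => by
      unfold kb
      apply Real.rpow_nonneg
      exact (Matrix.PosSemidef.one.add (by simpa using Matrix.posSemidef_self_mul_conjTranspose ((m:ℝ) • Z))).det_nonneg
    have hs1 : Summable (fun m : ℕ+ => 8 / π^2 * (1 / (4 * (m:ℝ)^2 - 1))) := by
      apply Summable.mul_left
      have hz : Summable (fun n : ℕ+ => 1 / (n:ℝ)^2) :=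
        (Real.summable_one_div_nat_pow.mpr (by norm_num : 1 < 2)).comp_injective PNat.coe_injective
      refine Summable.of_nonneg_of_le (fun m => div_nonneg zero_le_one (hden m).le) (fun m => ?_) hz
      have hm : (1:ℝ) ≤ (m:ℝ) := by exact_mod_cast m.one_le
      gcongr
      nlinarith
    refine Summable.of_nonneg_of_le hnon (fun m => ?_) hs1
    have := hden m
    have := hkb m
    gcongr
    linarith
  rw [hmain, ← tsum_mul_left, ENNReal.ofReal_tsum_of_nonneg hnon hsum]
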